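/- Let r₁,…,rₙ be distinct roots of the characteristic equation P(z)=0 with Re r_k < 0 for all 1 ≤ k ≤ n, and let K_D = (1/|V|)∫₀^∞ |Σ_{k=1}^n (−1)^k V_k e^{r_k x}| dx. Then every Ulam constant K of D satisfies K ≥ K_D; consequently K_D is the best (smallest) Ulam constant of D. -/

import Mathlib

open MeasureTheory

/-- The linear differential operator `D(y) = y⁽ⁿ⁾ + a₁ y⁽ⁿ⁻¹⁾ + ⋯ + aₙ y`,
where `a j` is the coefficient of `y⁽ⁿ⁻¹⁻ʲ⁾` (zero-based indexing). -/
noncomputable def Dop {X : Type*} [NormedAddCommGroup X] [NormedSpace ℂ X]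
    (n : ℕ) (a : Fin n → ℂ) (y : ℝ → X) : ℝ → X :=
  fun t => iteratedDeriv n y t + ∑ j : Fin n, a j • iteratedDeriv (n - 1 - (j : ℕ)) y t

/-- `K` is an Ulam constant of the operator `D` determined by the coefficients `a`:
for every `ε > 0` and every `n` times continuously differentiable `y` with
`‖D(y)‖_∞ ≤ ε` there is `z ∈ Ker D` with `‖y - z‖_∞ ≤ Kε`. -/
def IsUlamConstant {X : Type*} [NormedAddCommGroup X] [NormedSpace ℂ X]
    (n : ℕ) (a : Fin n → ℂ) (K : ℝ) : Prop :=
  0 ≤ K ∧ ∀ ε : ℝ, 0 < ε → ∀ y : ℝ → X, ContDiff ℝ n y →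
    (∀ t : ℝ, ‖Dop n a y t‖ ≤ ε) →
    ∃ z : ℝ → X, ContDiff ℝ n z ∧ Dop n a z = 0 ∧ ∀ t : ℝ, ‖y t - z t‖ ≤ K * ε

/-- Vandermonde determinant of `r₁, …, rₙ` with the `k`-th entry deleted. -/
noncomputable def VandDel {n : ℕ} (r : Fin (n + 1) → ℂ) (k : Fin (n + 1)) : ℂ :=
  (Matrix.vandermonde fun i : Fin n => r (k.succAbove i)).det

open Filter Topology

section ExpConvolution

variable {X : Type*} [NormedAddCommGroup X] [NormedSpace ℂ X]

/-- The convolution of `f` with `x ↦ exp (r x)` on the positive half-line. -/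
noncomputable def expConv (r : ℂ) (f : ℝ → X) (t : ℝ) : X :=
  ∫ x in Set.Ioi (0 : ℝ), Complex.exp (r * x) • f (t - x)

/-- The kernel `∑ cₖ exp (rₖ x)`. -/
noncomputable def expKernel {ι : Type*} [Fintype ι] (c r : ι → ℂ) (x : ℝ) : ℂ :=
  ∑ k, c k * Complex.exp (r k * x)

theorem integrableOn_exp_smul_comp_sub {r : ℂ} (hr : r.re < 0) {f : ℝ → X} (hf : Continuous f)
    {C : ℝ} (hC : ∀ t, ‖f t‖ ≤ C) (t : ℝ) :
    IntegrableOn (fun x : ℝ => Complex.exp (r * x) • f (t - x)) (Set.Ioi 0) :=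
  (integrableOn_exp_mul_complex_Ioi hr 0).smul_bdd C
    (Continuous.aestronglyMeasurable (by fun_prop)) (ae_of_all _ fun _ => hC _)

theorem integrableOn_exp_neg_smul {r : ℂ} (hr : r.re < 0) {f : ℝ → X} (hf : Continuous f)
    {C : ℝ} (hC : ∀ t, ‖f t‖ ≤ C) (t : ℝ) :
    IntegrableOn (fun s : ℝ => Complex.exp (-r * s) • f s) (Set.Iic t) :=
  (integrableOn_exp_mul_complex_Iic (by simpa using hr) t).smul_bdd C
    hf.aestronglyMeasurable (ae_of_all _ fun _ => hC _)

theorem expConv_eq (r : ℂ) (f : ℝ → X) (t : ℝ) :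
    expConv r f t =
      Complex.exp (r * t) • ∫ s in Set.Iic t, Complex.exp (-r * s) • f s := by
  have h := integral_sub_left_eq_self (μ := volume)
    ((Set.Iio t).indicator fun s : ℝ => Complex.exp (r * (t - s)) • f s) t
  rw [integral_indicator measurableSet_Iio, ← integral_Iic_eq_integral_Iio] at h
  rw [← integral_smul, expConv, ← integral_indicator measurableSet_Ioi]
  refine Eq.trans (integral_congr_ae (ae_of_all _ fun x => ?_)) (h.trans ?_)
  · by_cases hx : 0 < x <;> simp [Set.indicator, hx]
  · refine setIntegral_congr_fun measurableSet_Iic fun s _ => ?_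
    simp only [smul_smul, ← Complex.exp_add]
    ring_nf

variable {ι : Type*} [Fintype ι] {c r : ι → ℂ}

theorem integrableOn_expKernel (hre : ∀ k, (r k).re < 0) :
    IntegrableOn (expKernel c r) (Set.Ioi 0) :=
  integrable_finsetSum _ fun k _ => (integrableOn_exp_mul_complex_Ioi (hre k) 0).const_mul (c k)

@[fun_prop]
theorem continuous_expKernel : Continuous (expKernel c r) := by
  unfold expKernel
  fun_prop

theorem sum_smul_expConv (hre : ∀ k, (r k).re < 0) {f : ℝ → X} (hf : Continuous f)
    {C : ℝ} (hC : ∀ t, ‖f t‖ ≤ C) (t : ℝ) :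
    ∑ k, c k • expConv (r k) f t = ∫ x in Set.Ioi (0 : ℝ), expKernel c r x • f (t - x) := by
  simp only [expConv, expKernel, ← integral_smul, Finset.sum_smul, mul_smul]
  rw [integral_finsetSum]
  exact fun k _ => (integrableOn_exp_smul_comp_sub (hre k) hf hC t).smul (c k)

theorem norm_sum_smul_expConv_le (hre : ∀ k, (r k).re < 0) {f : ℝ → X} (hf : Continuous f)
    {C : ℝ} (hC : ∀ t, ‖f t‖ ≤ C) (t : ℝ) :
    ‖∑ k, c k • expConv (r k) f t‖ ≤ (∫ x in Set.Ioi (0 : ℝ), ‖expKernel c r x‖) * C := by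
  rw [sum_smul_expConv hre hf hC, ← integral_mul_const]
  refine norm_integral_le_of_norm_le ((integrableOn_expKernel hre).norm.mul_const C)
    (ae_of_all _ fun x => ?_)
  rw [norm_smul]
  exact mul_le_mul_of_nonneg_left (hC _) (norm_nonneg _)

variable [CompleteSpace X]

theorem hasDerivAt_expConv {r : ℂ} (hr : r.re < 0) {f : ℝ → X} (hf : Continuous f)
    {C : ℝ} (hC : ∀ t, ‖f t‖ ≤ C) (t : ℝ) :
    HasDerivAt (expConv r f) (r • expConv r f t + f t) t := by
  have hint := integrableOn_exp_neg_smul hr hf hC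
  have hcont : Continuous fun s : ℝ => Complex.exp (-r * s) • f s := by fun_prop
  have h1 : HasDerivAt (fun t : ℝ => ∫ s in Set.Iic t, Complex.exp (-r * s) • f s)
      (Complex.exp (-r * t) • f t) t := by
    have h := (hcont.integral_hasStrictDerivAt 0 t).hasDerivAt.const_add
      (∫ s in Set.Iic (0 : ℝ), Complex.exp (-r * s) • f s)
    refine h.congr_of_eventuallyEq (Eventually.of_forall fun u => ?_)
    simp only
    rw [← intervalIntegral.integral_Iic_sub_Iic (hint 0) (hint u)]
    abel
  have h2 : HasDerivAt (fun t : ℝ => Complex.exp (r * t)) (Complex.exp (r * t) * r) t := by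
    simpa using ((Complex.ofRealCLM.hasDerivAt (x := t)).const_mul r).cexp
  have h3 := (h2.smul h1).congr_of_eventuallyEq
    (Eventually.of_forall fun u => expConv_eq r f u)
  convert h3 using 1
  rw [expConv_eq, smul_smul, smul_smul, ← Complex.exp_add, add_comm]
  simp [mul_comm]

theorem hasDerivAt_sum_smul_expConv (hre : ∀ k, (r k).re < 0) {f : ℝ → X} (hf : Continuous f)
    {C : ℝ} (hC : ∀ t, ‖f t‖ ≤ C) (b : ι → ℂ) (t : ℝ) :
    HasDerivAt (fun t => ∑ k, b k • expConv (r k) f t)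
      (∑ k, (b k * r k) • expConv (r k) f t + (∑ k, b k) • f t) t := by
  have h := HasDerivAt.fun_sum (u := Finset.univ)
    fun k _ => (hasDerivAt_expConv (hre k) hf hC t).const_smul (b k)
  simpa only [smul_add, Finset.sum_add_distrib, smul_smul, Finset.sum_smul, Pi.smul_apply] using h

theorem iteratedDeriv_sum_smul_expConv (hre : ∀ k, (r k).re < 0) {f : ℝ → X} (hf : Continuous f)
    {C : ℝ} (hC : ∀ t, ‖f t‖ ≤ C) {n : ℕ} (hc : ∀ i < n, ∑ k, c k * r k ^ i = 0) {m : ℕ}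
    (hm : m ≤ n) :
    iteratedDeriv m (fun t => ∑ k, c k • expConv (r k) f t) =
      fun t => ∑ k, (c k * r k ^ m) • expConv (r k) f t := by
  induction m with
  | zero => simp
  | succ m ih =>
    rw [iteratedDeriv_succ, ih (by lia)]
    funext t
    rw [(hasDerivAt_sum_smul_expConv hre hf hC _ t).deriv, hc m (by lia)]
    simp [pow_succ, mul_assoc]

theorem iteratedDeriv_succ_sum_smul_expConv (hre : ∀ k, (r k).re < 0) {f : ℝ → X}
    (hf : Continuous f) {C : ℝ} (hC : ∀ t, ‖f t‖ ≤ C) {n : ℕ}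
    (hc : ∀ i < n, ∑ k, c k * r k ^ i = 0) (hcn : ∑ k, c k * r k ^ n = 1) :
    iteratedDeriv (n + 1) (fun t => ∑ k, c k • expConv (r k) f t) =
      fun t => ∑ k, (c k * r k ^ (n + 1)) • expConv (r k) f t + f t := by
  rw [iteratedDeriv_succ, iteratedDeriv_sum_smul_expConv hre hf hC hc le_rfl]
  funext t
  rw [(hasDerivAt_sum_smul_expConv hre hf hC _ t).deriv, hcn]
  simp [pow_succ, mul_assoc]

theorem contDiff_sum_smul_expConv (hre : ∀ k, (r k).re < 0) {f : ℝ → X}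
    (hf : Continuous f) {C : ℝ} (hC : ∀ t, ‖f t‖ ≤ C) {n : ℕ}
    (hc : ∀ i < n, ∑ k, c k * r k ^ i = 0) (hcn : ∑ k, c k * r k ^ n = 1) :
    ContDiff ℝ (n + 1 : ℕ) fun t => ∑ k, c k • expConv (r k) f t := by
  have hd (b : ι → ℂ) : Differentiable ℝ fun t => ∑ k, b k • expConv (r k) f t := fun t =>
    (hasDerivAt_sum_smul_expConv hre hf hC b t).differentiableAt
  rw [contDiff_nat_iff_iteratedDeriv]
  refine ⟨fun m hm => ?_, fun m hm => ?_⟩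
  · rcases hm.eq_or_lt with rfl | hm
    · rw [iteratedDeriv_succ_sum_smul_expConv hre hf hC hc hcn]
      exact (hd _).continuous.add hf
    · rw [iteratedDeriv_sum_smul_expConv hre hf hC hc (by lia)]
      exact (hd _).continuous
  · rw [iteratedDeriv_sum_smul_expConv hre hf hC hc (by lia)]
    exact hd _

theorem Dop_sum_smul_expConv (hre : ∀ k, (r k).re < 0) {f : ℝ → X}
    (hf : Continuous f) {C : ℝ} (hC : ∀ t, ‖f t‖ ≤ C) {n : ℕ} {a : Fin (n + 1) → ℂ}
    (hroot : ∀ k, r k ^ (n + 1) + ∑ j : Fin (n + 1), a j * r k ^ (n - (j : ℕ)) = 0)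
    (hc : ∀ i < n, ∑ k, c k * r k ^ i = 0) (hcn : ∑ k, c k * r k ^ n = 1) :
    Dop (n + 1) a (fun t => ∑ k, c k • expConv (r k) f t) = f := by
  funext t
  have h (j : Fin (n + 1)) : iteratedDeriv (n + 1 - 1 - (j : ℕ))
      (fun t => ∑ k, c k • expConv (r k) f t) t =
      ∑ k, (c k * r k ^ (n - (j : ℕ))) • expConv (r k) f t := by
    rw [iteratedDeriv_sum_smul_expConv hre hf hC hc (by lia), Nat.add_sub_cancel]
  simp only [Dop, h, iteratedDeriv_succ_sum_smul_expConv hre hf hC hc hcn, Finset.smul_sum,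
    smul_smul]
  rw [Finset.sum_comm, add_right_comm, ← Finset.sum_add_distrib]
  simp only [← Finset.sum_smul, ← add_smul]
  rw [Finset.sum_eq_zero, zero_add]
  intro k _
  have hk : c k * r k ^ (n + 1) + ∑ j : Fin (n + 1), a j * (c k * r k ^ (n - (j : ℕ))) = 0 := by
    rw [← mul_zero (c k), ← hroot k, mul_add, Finset.mul_sum]
    simp only [mul_left_comm]
  rw [hk, zero_smul]

end ExpConvolution

section Vandermonde

theorem sum_vandDel_mul_pow {n : ℕ} (r : Fin (n + 1) → ℂ) (i : ℕ) :
    ∑ k : Fin (n + 1), (-1 : ℂ) ^ ((k : ℕ) + n) * r k ^ i * VandDel r k =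
      ((Matrix.vandermonde r).updateCol (Fin.last n) fun k => r k ^ i).det := by
  rw [Matrix.det_succ_column _ (Fin.last n)]
  refine Finset.sum_congr rfl fun k _ => ?_
  simp only [Matrix.updateCol_self, Fin.val_last, VandDel]
  congr 2
  ext p q
  simp [Matrix.vandermonde_apply, Fin.castSucc_ne_last]

theorem sum_vandDel_mul_pow_of_lt {n : ℕ} (r : Fin (n + 1) → ℂ) {i : ℕ} (hi : i < n) :
    ∑ k : Fin (n + 1), (-1 : ℂ) ^ ((k : ℕ) + n) * r k ^ i * VandDel r k = 0 := by
  rw [sum_vandDel_mul_pow]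
  have hne : Fin.castSucc ⟨i, hi⟩ ≠ Fin.last n := Fin.castSucc_ne_last _
  refine Matrix.det_zero_of_column_eq hne fun k => ?_
  rw [Matrix.updateCol_ne hne, Matrix.updateCol_self, Matrix.vandermonde_apply, Fin.val_castSucc]

theorem sum_vandDel_mul_pow_self {n : ℕ} (r : Fin (n + 1) → ℂ) :
    ∑ k : Fin (n + 1), (-1 : ℂ) ^ ((k : ℕ) + n) * r k ^ n * VandDel r k =
      (Matrix.vandermonde r).det := by
  rw [sum_vandDel_mul_pow]
  congr 1
  ext p q
  rcases eq_or_ne q (Fin.last n) with rfl | hq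
  · simp
  · simp [Matrix.updateCol_ne hq]

end Vandermonde

section Kernel

variable {X : Type*} [NormedAddCommGroup X] [NormedSpace ℂ X]

theorem eq_zero_of_forall_norm_exp_smul_le {r : ℂ} (hr : r.re < 0) {x : X} {C : ℝ}
    (hC : ∀ t : ℝ, ‖Complex.exp (r * t) • x‖ ≤ C) : x = 0 := by
  by_contra hx
  have hx' : 0 < ‖x‖ := norm_pos_iff.2 hx
  have h := hC (C / ‖x‖ / r.re)
  rw [norm_smul, Complex.norm_exp, Complex.re_mul_ofReal, mul_div_cancel₀ _ hr.ne] at h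
  have h2 := mul_le_mul_of_nonneg_right (Real.add_one_le_exp (C / ‖x‖)) hx'.le
  rw [add_mul, div_mul_cancel₀ _ hx'.ne'] at h2
  linarith

theorem eq_of_forall_exp_mul_eq {r s : ℂ} (h : ∀ t : ℝ, Complex.exp (r * t) = Complex.exp (s * t)) :
    r = s := by
  have hd (r : ℂ) : HasDerivAt (fun t : ℝ => Complex.exp (r * t)) r 0 := by
    simpa using ((Complex.ofRealCLM.hasDerivAt (x := 0)).const_mul r).cexp
  exact (hd r).unique (by simpa only [h] using hd s)

/-- Distinct exponentials with decaying real parts have no nontrivial combination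
bounded on the whole line. -/
theorem eq_zero_of_forall_norm_sum_exp_smul_le {ι : Type*} {r : ι → ℂ}
    (hinj : Function.Injective r) (hre : ∀ k, (r k).re < 0) (s : Finset ι) (x : ι → X) (C : ℝ)
    (hC : ∀ t : ℝ, ‖∑ k ∈ s, Complex.exp (r k * t) • x k‖ ≤ C) : ∀ k ∈ s, x k = 0 := by
  classical
  induction s using Finset.induction_on generalizing x C with
  | empty => simp
  | insert j s hj ih =>
    have key : ∀ k ∈ s, x k = 0 := by
      intro k hk
      by_contra hxk
      refine hj (hinj (eq_of_forall_exp_mul_eq (r := r k) (s := r j) fun τ => ?_) ▸ hk)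
      have h := ih (fun k => (Complex.exp (r k * τ) - Complex.exp (r j * τ)) • x k)
        (C + ‖Complex.exp (r j * τ)‖ * C) (fun t => ?_) k hk
      · exact sub_eq_zero.1 ((smul_eq_zero.1 h).resolve_right hxk)
      · have e : ∑ k ∈ s, Complex.exp (r k * t) •
            ((Complex.exp (r k * τ) - Complex.exp (r j * τ)) • x k) =
            ∑ k ∈ insert j s, Complex.exp (r k * (t + τ : ℝ)) • x k -
              Complex.exp (r j * τ) • ∑ k ∈ insert j s, Complex.exp (r k * t) • x k := by
          rw [Finset.smul_sum, ← Finset.sum_sub_distrib, Finset.sum_insert hj]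
          simp only [smul_smul, ← sub_smul, Complex.ofReal_add, mul_add, Complex.exp_add]
          rw [mul_comm (Complex.exp (r j * t)), sub_self, zero_smul, zero_add]
          refine Finset.sum_congr rfl fun k _ => ?_
          congr 1
          ring
        rw [e]
        refine (norm_sub_le _ _).trans (add_le_add (hC _) ?_)
        rw [norm_smul]
        exact mul_le_mul_of_nonneg_left (hC t) (norm_nonneg _)
    have hxj : x j = 0 := by
      refine eq_zero_of_forall_norm_exp_smul_le (hre j) (C := C) fun t => ?_
      have h := hC t
      rwa [Finset.sum_insert hj, Finset.sum_eq_zero (s := s), add_zero] at h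
      intro k hk
      rw [key k hk, smul_zero]
    exact Finset.forall_mem_insert _ _ _ |>.2 ⟨hxj, key⟩

open Polynomial in
/-- The value at `t` of the constant-coefficient differential operator `Q(d/dt)` applied
to `z`. -/
noncomputable def polyDeriv (z : ℝ → X) (t : ℝ) : ℂ[X] →ₗ[ℂ] X :=
  Polynomial.lsum fun m => LinearMap.toSpanSingleton ℂ X (iteratedDeriv m z t)

theorem polyDeriv_monomial (z : ℝ → X) (t : ℝ) (m : ℕ) (b : ℂ) :
    polyDeriv z t (Polynomial.monomial m b) = b • iteratedDeriv m z t := by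
  simp [polyDeriv, Polynomial.lsum_apply, Polynomial.sum_monomial_index]

open Polynomial in
theorem hasDerivAt_polyDeriv {z : ℝ → X} {n : ℕ} (hz : ContDiff ℝ n z) {Q : ℂ[X]}
    (hQ : Q.natDegree < n) (t : ℝ) :
    HasDerivAt (fun t => polyDeriv z t Q) (polyDeriv z t (Polynomial.X * Q)) t := by
  rw [Q.as_sum_range' n hQ, Finset.mul_sum]
  simp only [map_sum, X_mul_monomial, polyDeriv_monomial]
  refine HasDerivAt.fun_sum fun m hm => HasDerivAt.fun_const_smul _ ?_
  rw [iteratedDeriv_succ]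
  exact ((contDiff_nat_iff_iteratedDeriv.1 hz).2 m (Finset.mem_range.1 hm) t).hasDerivAt

theorem eq_exp_smul_of_hasDerivAt {w : ℝ → X} {r : ℂ}
    (hw : ∀ t, HasDerivAt w (r • w t) t) (t : ℝ) : w t = Complex.exp (r * t) • w 0 := by
  have he (t : ℝ) : HasDerivAt (fun t : ℝ => Complex.exp (-r * t))
      (Complex.exp (-r * t) * -r) t := by
    simpa using ((Complex.ofRealCLM.hasDerivAt (x := t)).const_mul (-r)).cexp
  have hv (t : ℝ) : HasDerivAt (fun t : ℝ => Complex.exp (-r * t) • w t) 0 t := by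
    have h := (he t).smul (hw t)
    rwa [smul_smul, ← add_smul, mul_neg, add_neg_cancel, zero_smul] at h
  have h := is_const_of_deriv_eq_zero (fun t => (hv t).differentiableAt) (fun t => (hv t).deriv) t 0
  simp only [Complex.ofReal_zero, mul_zero, Complex.exp_zero, one_smul] at h
  rw [← h, smul_smul, ← Complex.exp_add]
  simp

open Polynomial in
/-- The characteristic polynomial of the operator `Dop (n + 1) a`. -/
noncomputable def charPoly {n : ℕ} (a : Fin (n + 1) → ℂ) : ℂ[X] :=
  Polynomial.X ^ (n + 1) + ∑ j : Fin (n + 1), monomial (n - (j : ℕ)) (a j)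

theorem polyDeriv_charPoly {n : ℕ} (a : Fin (n + 1) → ℂ) (z : ℝ → X) (t : ℝ) :
    polyDeriv z t (charPoly a) = Dop (n + 1) a z t := by
  simp [charPoly, Dop, Polynomial.X_pow_eq_monomial, polyDeriv_monomial]

theorem charPoly_eq_nodal {n : ℕ} {a r : Fin (n + 1) → ℂ}
    (hroot : ∀ k, r k ^ (n + 1) + ∑ j : Fin (n + 1), a j * r k ^ (n - (j : ℕ)) = 0)
    (hinj : Function.Injective r) :
    charPoly a = Lagrange.nodal Finset.univ r := by
  have hdeg : (∑ j : Fin (n + 1), Polynomial.monomial (n - (j : ℕ)) (a j)).degree <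
      ((n + 1 : ℕ) : WithBot ℕ) := by
    refine (Polynomial.degree_sum_le _ _).trans_lt ?_
    refine (Finset.sup_lt_iff (WithBot.bot_lt_coe _)).2 fun j _ => ?_
    exact (Polynomial.degree_monomial_le _ _).trans_lt (by exact_mod_cast (by lia))
  have hdeg' : (charPoly a).degree = (n + 1 : ℕ) := by
    rw [charPoly, Polynomial.degree_add_eq_left_of_degree_lt (by simpa using hdeg),
      Polynomial.degree_X_pow]
  refine Polynomial.eq_of_degree_le_of_eval_index_eq Finset.univ hinj.injOn ?_ ?_ ?_ ?_
  · simp [hdeg']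
  · simp [hdeg', Lagrange.degree_nodal]
  · rw [Lagrange.nodal_monic, charPoly]
    exact Polynomial.monic_X_pow_add hdeg
  · intro k hk
    rw [Lagrange.eval_nodal_at_node hk, ← hroot k]
    simp [charPoly, Polynomial.eval_finsetSum]

theorem eq_sum_exp_smul_of_Dop_eq_zero {n : ℕ} {a r : Fin (n + 1) → ℂ}
    (hroot : ∀ k, r k ^ (n + 1) + ∑ j : Fin (n + 1), a j * r k ^ (n - (j : ℕ)) = 0)
    (hinj : Function.Injective r) {z : ℝ → X} (hz : ContDiff ℝ (n + 1 : ℕ) z)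
    (hD : Dop (n + 1) a z = 0) :
    ∃ x : Fin (n + 1) → X, ∀ t : ℝ, z t = ∑ k, Complex.exp (r k * t) • x k := by
  set B := fun k => Lagrange.basis Finset.univ r k with hB
  have hBdeg (k) : (B k).natDegree < n + 1 := by
    simp [hB, Lagrange.natDegree_basis hinj.injOn (Finset.mem_univ k)]
  have hB0 (k) (t : ℝ) : polyDeriv z t (Polynomial.X * B k) = r k • polyDeriv z t (B k) := by
    obtain ⟨b, hb⟩ : ∃ b : ℂ, (Polynomial.X - Polynomial.C (r k)) * B k = b • charPoly a := by
      refine ⟨Lagrange.nodalWeight Finset.univ r k, ?_⟩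
      rw [charPoly_eq_nodal hroot hinj, Lagrange.nodal_eq_mul_nodal_erase (Finset.mem_univ k), hB]
      simp only
      rw [Lagrange.basis_eq_prod_sub_inv_mul_nodal_div (Finset.mem_univ k),
        ← Lagrange.nodal_erase_eq_nodal_div (Finset.mem_univ k), Polynomial.smul_eq_C_mul]
      ring
    have h := congrArg (polyDeriv z t) hb
    rw [map_smul, polyDeriv_charPoly, hD, sub_mul, map_sub, ← Polynomial.smul_eq_C_mul, map_smul,
      Pi.zero_apply, smul_zero, sub_eq_zero] at h
    exact h
  refine ⟨fun k => polyDeriv z 0 (B k), fun t => ?_⟩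
  have hw (k) := eq_exp_smul_of_hasDerivAt (w := fun t => polyDeriv z t (B k)) (r := r k)
    (fun t => hB0 k t ▸ hasDerivAt_polyDeriv hz (hBdeg k) t) t
  simp only [← hw]
  rw [← map_sum, Lagrange.sum_basis hinj.injOn Finset.univ_nonempty, ← Polynomial.monomial_zero_one,
    polyDeriv_monomial]
  simp

theorem eq_zero_of_Dop_eq_zero_of_bounded {n : ℕ} {a r : Fin (n + 1) → ℂ}
    (hroot : ∀ k, r k ^ (n + 1) + ∑ j : Fin (n + 1), a j * r k ^ (n - (j : ℕ)) = 0)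
    (hinj : Function.Injective r) (hre : ∀ k, (r k).re < 0) {z : ℝ → X}
    (hz : ContDiff ℝ (n + 1 : ℕ) z) (hD : Dop (n + 1) a z = 0) {C : ℝ} (hC : ∀ t, ‖z t‖ ≤ C) :
    z = 0 := by
  obtain ⟨x, hx⟩ := eq_sum_exp_smul_of_Dop_eq_zero hroot hinj hz hD
  have h := eq_zero_of_forall_norm_sum_exp_smul_le hinj hre Finset.univ x C fun t => hx t ▸ hC t
  funext t
  simp [hx, h]

theorem Dop_sub {n : ℕ} (a : Fin n → ℂ) {y z : ℝ → X} (hy : ContDiff ℝ n y)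
    (hz : ContDiff ℝ n z) : Dop n a (y - z) = Dop n a y - Dop n a z := by
  have h {m : ℕ} (hm : m ≤ n) (t : ℝ) :
      iteratedDeriv m (y - z) t = iteratedDeriv m y t - iteratedDeriv m z t :=
    iteratedDeriv_sub (hy.of_le (by exact_mod_cast hm)).contDiffAt
      (hz.of_le (by exact_mod_cast hm)).contDiffAt
  funext t
  simp only [Dop, Pi.sub_apply]
  rw [h le_rfl, Finset.sum_congr rfl fun j _ => by rw [h (by lia), smul_sub],
    Finset.sum_sub_distrib]
  abel

theorem continuous_Dop {n : ℕ} (a : Fin n → ℂ) {y : ℝ → X} (hy : ContDiff ℝ n y) :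
    Continuous (Dop n a y) := by
  have h := (contDiff_nat_iff_iteratedDeriv.1 hy).1
  exact (h n le_rfl).add (continuous_finsetSum _ fun j _ => (h _ (by lia)).const_smul _)

end Kernel

section Sharpness

theorem integral_norm_le_of_forall_integral_sq_div_le {α : Type*} [MeasurableSpace α]
    {μ : Measure α} {g : α → ℂ} (hg : Integrable g μ) {K : ℝ}
    (hK : ∀ δ : ℝ, 0 < δ → ∫ x, ‖g x‖ ^ 2 / (‖g x‖ + δ) ∂μ ≤ K) : ∫ x, ‖g x‖ ∂μ ≤ K := by
  have hlim : Tendsto (fun δ : ℝ => ∫ x, ‖g x‖ ^ 2 / (‖g x‖ + δ) ∂μ) (𝓝[>] 0)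
      (𝓝 (∫ x, ‖g x‖ ∂μ)) := by
    refine tendsto_integral_filter_of_dominated_convergence (fun x => ‖g x‖)
      (Eventually.of_forall fun δ => ?_) ?_ hg.norm (ae_of_all _ fun x => ?_)
    · exact ((hg.aestronglyMeasurable.norm.aemeasurable.pow_const 2).div
        (hg.aestronglyMeasurable.norm.aemeasurable.add_const δ)).aestronglyMeasurable
    · filter_upwards [self_mem_nhdsWithin] with δ hδ
      have hδ : 0 < δ := hδ
      refine ae_of_all _ fun x => ?_
      rw [Real.norm_of_nonneg (by positivity), div_le_iff₀ (by positivity)]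
      nlinarith [norm_nonneg (g x)]
    · rcases eq_or_ne (g x) 0 with h | h
      · simp [h]
      · have hx : ‖g x‖ + 0 ≠ 0 := by simpa using h
        have ht : Tendsto (fun δ : ℝ => ‖g x‖ ^ 2 / (‖g x‖ + δ)) (𝓝 0)
            (𝓝 (‖g x‖ ^ 2 / (‖g x‖ + 0))) :=
          tendsto_const_nhds.div (tendsto_const_nhds.add tendsto_id) hx
        have hx' : ‖g x‖ ^ 2 / (‖g x‖ + 0) = ‖g x‖ := by rw [add_zero, sq, mul_self_div_self]
        rw [hx'] at ht
        exact ht.mono_left nhdsWithin_le_nhds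
  exact le_of_tendsto hlim (eventually_mem_nhdsWithin.mono fun δ hδ => hK δ hδ)

variable {X : Type*} [NormedAddCommGroup X] [NormedSpace ℂ X] [CompleteSpace X]
  {n : ℕ} {a r c : Fin (n + 1) → ℂ}

theorem isUlamConstant_integral_norm_expKernel
    (hroot : ∀ k, r k ^ (n + 1) + ∑ j : Fin (n + 1), a j * r k ^ (n - (j : ℕ)) = 0)
    (hre : ∀ k, (r k).re < 0) (hc : ∀ i < n, ∑ k, c k * r k ^ i = 0)
    (hcn : ∑ k, c k * r k ^ n = 1) :
    IsUlamConstant (X := X) (n + 1) a (∫ x in Set.Ioi (0 : ℝ), ‖expKernel c r x‖) := by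
  refine ⟨integral_nonneg fun _ => norm_nonneg _, fun ε _ y hy hε => ?_⟩
  have hf := continuous_Dop a hy
  have hp := contDiff_sum_smul_expConv hre hf hε hc hcn
  refine ⟨y - fun t => ∑ k, c k • expConv (r k) (Dop (n + 1) a y) t, hy.sub hp, ?_, fun t => ?_⟩
  · rw [Dop_sub a hy hp, Dop_sum_smul_expConv hre hf hε hroot hc hcn, sub_self]
  · simpa using norm_sum_smul_expConv_le (c := c) hre hf hε t

theorem integral_norm_expKernel_le_of_isUlamConstant [Nontrivial X]
    (hroot : ∀ k, r k ^ (n + 1) + ∑ j : Fin (n + 1), a j * r k ^ (n - (j : ℕ)) = 0)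
    (hinj : Function.Injective r)
    (hre : ∀ k, (r k).re < 0) (hc : ∀ i < n, ∑ k, c k * r k ^ i = 0)
    (hcn : ∑ k, c k * r k ^ n = 1) {K : ℝ} (hK : IsUlamConstant (X := X) (n + 1) a K) :
    ∫ x in Set.Ioi (0 : ℝ), ‖expKernel c r x‖ ≤ K := by
  refine integral_norm_le_of_forall_integral_sq_div_le (integrableOn_expKernel hre) fun δ hδ => ?_
  obtain ⟨u, hu⟩ := exists_norm_eq X zero_le_one
  have hpos (s : ℝ) : 0 < ‖expKernel c r (-s)‖ + δ := by positivity
  set f : ℝ → X := fun s => ((‖expKernel c r (-s)‖ + δ)⁻¹ : ℝ) •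
    ((starRingEnd ℂ) (expKernel c r (-s)) • u) with hf_def
  have hf : Continuous f := by
    have h1 : Continuous fun s => expKernel c r (-s) := continuous_expKernel.comp continuous_neg
    exact ((h1.norm.add_const δ).inv₀ fun s => (hpos s).ne').smul
      ((Complex.continuous_conj.comp h1).smul continuous_const)
  have hf1 (s : ℝ) : ‖f s‖ ≤ 1 := by
    rw [hf_def]
    simp only [norm_smul, hu, mul_one, RCLike.norm_conj]
    rw [Real.norm_of_nonneg (inv_nonneg.2 (hpos s).le), inv_mul_le_one₀ (hpos s)]
    linarith
  have hp := contDiff_sum_smul_expConv hre hf hf1 hc hcn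
  obtain ⟨z, hz, hDz, hyz⟩ := hK.2 1 one_pos _ hp fun t => by
    rw [Dop_sum_smul_expConv hre hf hf1 hroot hc hcn]
    exact hf1 t
  have hz0 : z = 0 := eq_zero_of_Dop_eq_zero_of_bounded hroot hinj hre hz hDz fun t =>
    (norm_le_norm_add_norm_sub _ (z t)).trans
      (add_le_add (norm_sum_smul_expConv_le hre hf hf1 t) (hyz t))
  have h := hyz 0
  rw [hz0, Pi.zero_apply, sub_zero, mul_one, sum_smul_expConv hre hf hf1] at h
  have he (x : ℝ) : expKernel c r x • f (0 - x) =
      (‖expKernel c r x‖ ^ 2 / (‖expKernel c r x‖ + δ)) • u := by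
    simp only [hf_def, zero_sub, neg_neg]
    rw [smul_comm, smul_smul, Complex.mul_conj', div_eq_inv_mul, mul_smul]
    norm_cast
  simp only [he] at h
  rw [integral_smul_const, norm_smul, hu, mul_one] at h
  exact (Real.le_norm_self _).trans h

end Sharpness

theorem stmt6 {X : Type*} [NormedAddCommGroup X] [NormedSpace ℂ X] [CompleteSpace X] [Nontrivial X]
    (n : ℕ) (a : Fin (n + 1) → ℂ) (r : Fin (n + 1) → ℂ)
    (hroot : ∀ k, r k ^ (n + 1) + ∑ j : Fin (n + 1), a j * r k ^ (n - (j : ℕ)) = 0)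
    (hinj : Function.Injective r)
    (hre : ∀ k, (r k).re < 0)
    (KD : ℝ)
    (hKD : KD = (1 / ‖(Matrix.vandermonde r).det‖) *
      ∫ x in Set.Ioi (0 : ℝ), ‖∑ k : Fin (n + 1), (-1 : ℂ) ^ ((k : ℕ) + 1) *
        VandDel r k * Complex.exp (r k * x)‖) :
    IsUlamConstant (X := X) (n + 1) a KD ∧
      ∀ K : ℝ, IsUlamConstant (X := X) (n + 1) a K → KD ≤ K := by

  have hV : (Matrix.vandermonde r).det ≠ 0 := Matrix.det_vandermonde_ne_zero_iff.2 hinj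
  set c : Fin (n + 1) → ℂ :=
    fun k => (-1) ^ ((k : ℕ) + n) * VandDel r k / (Matrix.vandermonde r).det with hc_def
  have hsum (i : ℕ) : ∑ k, c k * r k ^ i = (∑ k : Fin (n + 1), (-1 : ℂ) ^ ((k : ℕ) + n) *
      r k ^ i * VandDel r k) / (Matrix.vandermonde r).det := by
    rw [Finset.sum_div]
    exact Finset.sum_congr rfl fun k _ => by rw [hc_def]; ring
  have hc (i : ℕ) (hi : i < n) : ∑ k, c k * r k ^ i = 0 := by
    rw [hsum, sum_vandDel_mul_pow_of_lt r hi, zero_div]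
  have hcn : ∑ k, c k * r k ^ n = 1 := by
    rw [hsum, sum_vandDel_mul_pow_self, div_self hV]
  have hnorm (x : ℝ) : ‖expKernel c r x‖ = 1 / ‖(Matrix.vandermonde r).det‖ *
      ‖∑ k : Fin (n + 1), (-1 : ℂ) ^ ((k : ℕ) + 1) * VandDel r k * Complex.exp (r k * x)‖ := by
    have h : expKernel c r x = (-1) ^ (n + 1) * (1 / (Matrix.vandermonde r).det *
        ∑ k : Fin (n + 1), (-1 : ℂ) ^ ((k : ℕ) + 1) * VandDel r k * Complex.exp (r k * x)) := by
      rw [expKernel, Finset.mul_sum, Finset.mul_sum]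
      exact Finset.sum_congr rfl fun k _ => by rw [hc_def]; ring
    rw [h]
    simp
  have hKD' : KD = ∫ x in Set.Ioi (0 : ℝ), ‖expKernel c r x‖ := by
    simp only [hKD, hnorm, integral_const_mul]
  rw [hKD']
  exact ⟨isUlamConstant_integral_norm_expKernel hroot hre hc hcn, fun K hK =>
    integral_norm_expKernel_le_of_isUlamConstant hroot hinj hre hc hcn hK⟩
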